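/- arXiv:1710.09708 — 2 statements merged into one kernel-verified Lean document; each statement's English description precedes it below -/
import Mathlib

section
/- For b > 0 and z ∈ ℂ not a nonpositive integer, the series ∑_{k=0}^∞ C(b-1, k)·(-1)^k/(k + z) converges to Γ(z)Γ(b)/Γ(z+b), where C(b-1,k) = (b-1)(b-2)···(b-k)/k! is the generalized binomial coefficient. -/
open Complex

/-- Generalized binomial coefficient `C(b-1, k) = (b-1)(b-2)⋯(b-k)/k!`. -/
noncomputable def genBinom (b : ℂ) (k : ℕ) : ℂ :=
  (∏ j ∈ Finset.range k, (b - 1 - j)) / (Nat.factorial k)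

open Filter Topology MeasureTheory

lemma genBinom_eq_choose (b : ℂ) (k : ℕ) : genBinom b k = Ring.choose (b - 1) k := by
  rw [Ring.choose_eq_smul, ← Polynomial.aeval_eq_smeval, ← Polynomial.aeval_map_algebraMap ℂ,
    algebraMap_int_eq, descPochhammer_map]
  simp [genBinom, descPochhammer_eval_eq_prod_range, div_eq_inv_mul]

lemma hasSum_genBinom_mul_pow (b : ℂ) {t : ℂ} (ht : ‖t‖ < 1) :
    HasSum (fun k ↦ genBinom b k * (-1) ^ k * t ^ k) ((1 - t) ^ (b - 1)) := by
  have h := (one_add_cpow_hasFPowerSeriesOnBall_zero (a := b - 1)).hasSum (y := -t)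
    (by simpa [enorm_eq_nnnorm] using! ht)
  rw [zero_add, ← sub_eq_add_neg] at h
  convert! h using 2 with k
  rw [binomialSeries_apply, genBinom_eq_choose, List.ofFn_const, List.prod_replicate, neg_pow t,
    smul_eq_mul, mul_assoc]

lemma genBinom_succ_mul (b : ℂ) (k : ℕ) :
    genBinom b (k + 1) * (-1) ^ (k + 1) * (k + 1) = genBinom b k * (-1) ^ k * (k + 1 - b) := by
  have h : (Nat.factorial k : ℂ) ≠ 0 := mod_cast k.factorial_ne_zero
  have h' : (k : ℂ) + 1 ≠ 0 := mod_cast k.succ_ne_zero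
  simp only [genBinom, Finset.prod_range_succ, Nat.factorial_succ, Nat.cast_mul, Nat.cast_succ]
  field_simp
  ring

/-- For `b > 0` the moduli of the coefficients are eventually decreasing with increments
`-b * ‖·‖ / (k + 1)`, so the series of these increments telescopes. -/
lemma summable_norm_genBinom_div {b : ℝ} (hb : 0 < b) :
    Summable (fun k : ℕ ↦ ‖genBinom b k‖ / (k + 1)) := by
  obtain ⟨N, hN⟩ := exists_nat_ge b
  rw [← summable_nat_add_iff N]
  have step (i : ℕ) : b * (‖genBinom b (i + N)‖ / ((i + N : ℕ) + 1)) =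
      ‖genBinom b (i + N)‖ - ‖genBinom b (i + 1 + N)‖ := by
    have h := congrArg norm (genBinom_succ_mul b (i + N))
    have e : ((i + N : ℕ) : ℂ) + 1 - b = (((i + N : ℕ) + 1 - b : ℝ) : ℂ) := by push_cast; ring
    have e' : ((i + N : ℕ) : ℂ) + 1 = (((i + N : ℕ) + 1 : ℝ) : ℂ) := by push_cast; ring
    have hpos : (0 : ℝ) < (i + N : ℕ) + 1 := by positivity
    have hnn : (0 : ℝ) ≤ (i + N : ℕ) + 1 - b := by
      push_cast
      linarith [Nat.cast_nonneg (α := ℝ) i]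
    rw [e, e'] at h
    simp only [norm_mul, norm_pow, norm_neg, norm_one, one_pow, mul_one, norm_real,
      Real.norm_of_nonneg hpos.le, Real.norm_of_nonneg hnn] at h
    rw [show i + 1 + N = i + N + 1 by ring]
    field_simp
    linarith
  refine summable_of_sum_range_le (c := ‖genBinom b N‖ / b) (fun i ↦ by positivity) fun n ↦ ?_
  rw [le_div_iff₀' hb, Finset.mul_sum, Finset.sum_congr rfl fun i _ ↦ step i,
    Finset.sum_range_sub' (fun i ↦ ‖genBinom b (i + N)‖)]
  simp

lemma summable_genBinom_div_add {b : ℝ} (hb : 0 < b) (z : ℂ) :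
    Summable (fun k : ℕ ↦ genBinom b k * (-1) ^ k / (k + z)) := by
  obtain ⟨N, hN⟩ := exists_nat_ge (2 * ‖z‖ + 1)
  refine Summable.of_norm_bounded_eventually_nat ((summable_norm_genBinom_div hb).mul_left 2) ?_
  filter_upwards [eventually_ge_atTop N] with k hk
  have hk' : (N : ℝ) ≤ k := mod_cast hk
  have h1 : (k : ℝ) ≤ ‖(k : ℂ) + z‖ + ‖z‖ := by
    simpa using norm_sub_le ((k : ℂ) + z) z
  have h2 : (k + 1 : ℝ) / 2 ≤ ‖(k : ℂ) + z‖ := by linarith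
  have h3 : 2 * (‖genBinom b k‖ / (k + 1)) = ‖genBinom b k‖ / ((k + 1) / 2) := by
    field_simp
  rw [h3]
  simp only [norm_div, norm_mul, norm_pow, norm_neg, norm_one, one_pow, mul_one]
  gcongr

lemma tendsto_genBinom_zero {b : ℝ} (hb : 0 < b) :
    Tendsto (fun k ↦ genBinom b k * (-1) ^ k) atTop (𝓝 0) := by
  have hs := summable_genBinom_div_add hb 1
  obtain ⟨L, hL⟩ : ∃ L, Tendsto (fun k ↦ genBinom b k * (-1) ^ k) atTop (𝓝 L) := by
    have h := ((hs.mul_left (-b : ℂ)).hasSum.tendsto_sum_nat).add_const (genBinom b 0 * (-1) ^ 0)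
    refine ⟨_, h.congr fun n ↦ ?_⟩
    rw [← eq_sub_iff_add_eq, ← Finset.sum_range_sub (fun k ↦ genBinom b k * (-1) ^ k)]
    refine Finset.sum_congr rfl fun k _ ↦ ?_
    have h' : (k : ℂ) + 1 ≠ 0 := mod_cast k.succ_ne_zero
    rw [eq_div_of_mul_eq h' (genBinom_succ_mul b k)]
    field_simp
    ring
  obtain rfl | hL0 := eq_or_ne L 0
  · exact hL
  have hO : (fun _ ↦ (1 : ℂ)) =O[atTop] fun k ↦ genBinom b k * (-1) ^ k :=
    (Asymptotics.isBigO_const_left_iff_pos_le_norm one_ne_zero).2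
      ⟨‖L‖ / 2, by positivity, (hL.norm.eventually_const_le (half_lt_self (norm_pos_iff.2 hL0)))⟩
  have hO' := hO.mul (Asymptotics.isBigO_refl (fun k : ℕ ↦ ((k : ℂ) + 1)⁻¹) atTop)
  have h1 := (summable_of_isBigO_nat' (g := fun k : ℕ ↦ genBinom b k * (-1) ^ k / (k + 1))
    hs (by simpa only [div_eq_mul_inv] using hO')).norm
  refine absurd ?_ Real.not_summable_one_div_natCast
  rw [← summable_nat_add_iff 1]
  refine h1.congr fun k ↦ ?_
  rw [one_mul, norm_inv, one_div, ← Nat.cast_succ, Complex.norm_natCast]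

lemma HasSum.genBinom_div_of_add_one {b : ℝ} (hb : 0 < b) {z S : ℂ} (hz : ∀ n : ℕ, z ≠ -(n : ℂ))
    (h : HasSum (fun k : ℕ ↦ genBinom b k * (-1) ^ k / (k + (z + 1))) S) :
    HasSum (fun k : ℕ ↦ genBinom b k * (-1) ^ k / (k + z)) ((z + b) / z * S) := by
  have hz0 : z ≠ 0 := by simpa using hz 0
  have hkz (k : ℕ) : (k : ℂ) + z ≠ 0 := fun h0 ↦ hz k (eq_neg_of_add_eq_zero_right h0)
  have hs := summable_genBinom_div_add hb z
  set G : ℕ → ℂ := fun k ↦ genBinom b k * (-1) ^ k * (k / (k + z)) with hG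
  have hG0 : Tendsto G atTop (𝓝 0) := by
    simpa using (tendsto_genBinom_zero hb).mul (tendsto_natCast_div_add_atTop z)
  have key (k : ℕ) : z * (genBinom b k * (-1) ^ k / (k + z)) -
      (z + b) * (genBinom b k * (-1) ^ k / (k + (z + 1))) = G (k + 1) - G k := by
    have h' : (k : ℂ) + 1 ≠ 0 := mod_cast k.succ_ne_zero
    have h1 := hkz k
    have h2 : (k : ℂ) + (z + 1) ≠ 0 := by
      have := hkz (k + 1)
      push_cast at this
      rwa [add_comm z, ← add_assoc]
    have h3 : ((k + 1 : ℕ) : ℂ) + z = k + (z + 1) := by push_cast; ring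
    simp only [hG]
    rw [h3, Nat.cast_succ, eq_div_of_mul_eq h' (genBinom_succ_mul b k)]
    field_simp
    ring
  have hd := (hs.hasSum.mul_left z).sub (h.mul_left (z + b))
  have hlim : Tendsto (fun n ↦ ∑ k ∈ Finset.range n, (G (k + 1) - G k)) atTop (𝓝 0) := by
    simp_rw [Finset.sum_range_sub]
    simpa [hG] using hG0
  have heq := tendsto_nhds_unique (hd.tendsto_sum_nat.congr fun n ↦
    Finset.sum_congr rfl fun k _ ↦ key k) hlim
  convert hs.hasSum using 1
  field_simp
  linear_combination -heq

lemma hasSum_genBinom_div_of_one_le_re {b : ℝ} (hb : 0 < b) {z : ℂ} (hz : 1 ≤ z.re) :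
    HasSum (fun k : ℕ ↦ genBinom b k * (-1) ^ k / (k + z)) (betaIntegral z b) := by
  set F : ℕ → ℝ → ℂ := fun k t ↦ genBinom b k * (-1) ^ k * (t : ℂ) ^ ((k : ℂ) + z - 1) with hF
  have hre (k : ℕ) : -1 < ((k : ℂ) + z - 1).re := by
    simp
    linarith [Nat.cast_nonneg (α := ℝ) k]
  have hint (k : ℕ) : Integrable (F k) (volume.restrict (Set.Ioc 0 1)) := by
    refine Integrable.const_mul ?_ _
    exact (intervalIntegrable_iff_integrableOn_Ioc_of_le zero_le_one).1
      (intervalIntegral.intervalIntegrable_cpow' (hre k))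
  have hnorm (k : ℕ) : ∫ t in Set.Ioc (0 : ℝ) 1, ‖F k t‖ = ‖genBinom b k‖ / (k + z.re) := by
    have : ∀ t ∈ Set.Ioc (0 : ℝ) 1, ‖F k t‖ = ‖genBinom b k‖ * t ^ ((k : ℝ) + z.re - 1) := by
      intro t ht
      simp [hF, norm_cpow_eq_rpow_re_of_pos ht.1]
    rw [setIntegral_congr_fun measurableSet_Ioc this, integral_const_mul,
      ← intervalIntegral.integral_of_le zero_le_one, integral_rpow (Or.inl (by simpa using hre k))]
    have h0 : (k : ℝ) + z.re ≠ 0 := by positivity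
    simp [h0, div_eq_mul_inv]
  have hval (k : ℕ) : ∫ t in Set.Ioc (0 : ℝ) 1, F k t = genBinom b k * (-1) ^ k / (k + z) := by
    have h0 : (k : ℂ) + z ≠ 0 := by
      intro h
      have := congrArg re h
      simp at this
      linarith [Nat.cast_nonneg (α := ℝ) k]
    simp only [hF]
    rw [integral_const_mul, ← intervalIntegral.integral_of_le zero_le_one,
      integral_cpow (Or.inl (hre k))]
    simp [h0, div_eq_mul_inv]
  have h := hasSum_integral_of_summable_integral_norm hint (by
    simp_rw [hnorm]
    refine (summable_norm_genBinom_div hb).of_nonneg_of_le (fun k ↦ by positivity) fun k ↦ ?_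
    gcongr)
  simp_rw [hval] at h
  convert! h using 1
  rw [betaIntegral, intervalIntegral.integral_of_le zero_le_one, integral_Ioc_eq_integral_Ioo,
    integral_Ioc_eq_integral_Ioo]
  refine setIntegral_congr_fun measurableSet_Ioo fun t ht ↦ ?_
  have ht0 : (t : ℂ) ≠ 0 := mod_cast ht.1.ne'
  have hs := (hasSum_genBinom_mul_pow b (t := t)
    (by simpa [abs_of_pos ht.1] using ht.2)).mul_left ((t : ℂ) ^ (z - 1))
  rw [← hs.tsum_eq]
  refine tsum_congr fun k ↦ ?_
  simp only [hF]
  rw [add_sub_assoc, cpow_add _ _ ht0, cpow_natCast]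
  ring

theorem stmt_7 (b : ℝ) (hb : 0 < b) (z : ℂ) (hz : ∀ n : ℕ, z ≠ -(n : ℂ)) :
    HasSum (fun k : ℕ => genBinom (b : ℂ) k * (-1) ^ k / ((k : ℂ) + z))
      (Complex.Gamma z * Complex.Gamma (b : ℂ) / Complex.Gamma (z + b)) := by
  obtain ⟨n, hn⟩ := exists_nat_ge (1 - z.re)
  induction n generalizing z with
  | zero =>
    have hz1 : 1 ≤ z.re := by
      rw [Nat.cast_zero] at hn
      linarith
    rw [Gamma_mul_Gamma_eq_betaIntegral (by linarith) (by simpa using hb),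
      mul_div_cancel_left₀ _ (Gamma_ne_zero_of_re_pos (by simp; linarith))]
    exact hasSum_genBinom_div_of_one_le_re hb hz1
  | succ n ih =>
    have h := HasSum.genBinom_div_of_add_one hb hz (ih (z + 1)
      (fun m hm ↦ hz (m + 1) (by push_cast; linear_combination hm))
      (by push_cast at hn; simp; linarith))
    have hz0 : z ≠ 0 := by simpa using hz 0
    convert h using 1
    rw [Gamma_add_one z hz0, add_right_comm]
    obtain h0 | h0 := eq_or_ne (z + b) 0
    · simp [h0]
    · rw [Gamma_add_one _ h0]
      field_simp
end

section
/- For a natural number n and b > 0, ∑_{k ≠ n} C(b-1,k)·(-1)^k/(k - n) = -C(b-1,n)·(-1)^n·( ∑_{k≠n} (1/(k-n) - 1/(k+b-n)) - 1/b ). -/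
/-- Generalized binomial coefficient `C(b-1, k) = (b-1)(b-2)⋯(b-k)/k!`. -/
noncomputable def genBinomR (b : ℝ) (k : ℕ) : ℝ :=
  (∏ j ∈ Finset.range k, (b - 1 - j)) / (Nat.factorial k)

open Filter Topology

theorem HasSum.of_eq {f g : ℕ → ℝ} {s t : ℝ} (h : HasSum f s) (hfg : ∀ k, g k = f k)
    (hst : t = s) : HasSum g t := by
  rwa [funext hfg, hst]

theorem hasSum_sub_succ_of_tendsto_zero {c : ℕ → ℝ} (hs : Summable fun k => c k - c (k + 1))
    (hc : Tendsto c atTop (𝓝 0)) : HasSum (fun k => c k - c (k + 1)) (c 0) := by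
  rw [hs.hasSum_iff_tendsto_nat]
  simp only [Finset.sum_range_sub']
  simpa using hc.const_sub (c 0)

theorem hasSum_sub_succ_of_antitone {c : ℕ → ℝ} (ha : Antitone c)
    (hc : Tendsto c atTop (𝓝 0)) : HasSum (fun k => c k - c (k + 1)) (c 0) := by
  rw [hasSum_iff_tendsto_nat_of_nonneg (fun k => sub_nonneg.2 (ha k.le_succ))]
  simp only [Finset.sum_range_sub']
  simpa using hc.const_sub (c 0)

/-- The coefficient of `x ^ k` in the expansion of `(1 - x) ^ (b - 1)`. -/
noncomputable def altBinom (b : ℝ) (k : ℕ) : ℝ := genBinomR b k * (-1) ^ k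

theorem altBinom_zero (b : ℝ) : altBinom b 0 = 1 := by simp [altBinom, genBinomR]

theorem succ_mul_altBinom_succ (b : ℝ) (k : ℕ) :
    ((k : ℝ) + 1) * altBinom b (k + 1) = (k + 1 - b) * altBinom b k := by
  have h : (Nat.factorial k : ℝ) ≠ 0 := by positivity
  have h' : (k : ℝ) + 1 ≠ 0 := by positivity
  simp only [altBinom, genBinomR, Finset.prod_range_succ, Nat.factorial_succ, pow_succ]
  push_cast
  field_simp
  ring

theorem altBinom_sub_succ (b : ℝ) (k : ℕ) :
    altBinom b k - altBinom b (k + 1) = b * (altBinom b k / (k + 1)) := by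
  have h' : (k : ℝ) + 1 ≠ 0 := by positivity
  have := succ_mul_altBinom_succ b k
  field_simp
  linarith

theorem abs_altBinom_sub_succ {b : ℝ} {k : ℕ} (hk : b ≤ k) :
    |altBinom b k| - |altBinom b (k + 1)| = b * (|altBinom b k| / (k + 1)) := by
  have h' : (0 : ℝ) < (k : ℝ) + 1 := by positivity
  have := congrArg abs (succ_mul_altBinom_succ b k)
  rw [abs_mul, abs_mul, abs_of_pos h', abs_of_nonneg (by linarith : 0 ≤ (k : ℝ) + 1 - b)] at this
  field_simp
  linarith

theorem summable_abs_altBinom_div {b : ℝ} (hb : 0 < b) :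
    Summable fun k : ℕ => |altBinom b k| / ((k : ℝ) + 1) := by
  obtain ⟨K, hK⟩ := exists_nat_ge b
  rw [← summable_nat_add_iff K, ← summable_mul_left_iff hb.ne']
  refine summable_of_sum_range_le (c := |altBinom b K|) (fun k => by positivity) fun n => ?_
  have h (k : ℕ) : b * (|altBinom b (k + K)| / (((k + K : ℕ) : ℝ) + 1))
      = |altBinom b (k + K)| - |altBinom b (k + 1 + K)| := by
    rw [← abs_altBinom_sub_succ (by push_cast; linarith [(k.cast_nonneg : (0 : ℝ) ≤ k)]),
      add_right_comm]
  simp only [h, Finset.sum_range_sub' (fun k => |altBinom b (k + K)|)]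
  simp

theorem tendsto_altBinom {b : ℝ} (hb : 0 < b) : Tendsto (altBinom b) atTop (𝓝 0) := by
  obtain ⟨K, hK⟩ := exists_nat_ge b
  rw [tendsto_zero_iff_abs_tendsto_zero, ← tendsto_add_atTop_iff_nat K]
  have anti : Antitone fun k => |altBinom b (k + K)| := by
    refine antitone_nat_of_succ_le fun k => ?_
    have := abs_altBinom_sub_succ (b := b) (k := k + K)
      (by push_cast; linarith [(k.cast_nonneg : (0 : ℝ) ≤ k)])
    rw [add_right_comm, ← sub_nonneg, this]
    positivity
  have bdd : BddBelow (Set.range fun k => |altBinom b (k + K)|) :=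
    ⟨0, by rintro _ ⟨k, rfl⟩; positivity⟩
  have lim := tendsto_atTop_ciInf anti bdd
  set L := ⨅ k, |altBinom b (k + K)|
  have hle (k : ℕ) : L ≤ |altBinom b (k + K)| := ciInf_le bdd k
  have hL0 : 0 ≤ L := le_ciInf fun k => abs_nonneg _
  rcases hL0.eq_or_lt with h | h
  · rw [h]
    exact lim
  · exfalso
    have hs := (summable_nat_add_iff K).2 (summable_abs_altBinom_div hb)
    have hs' : Summable fun k : ℕ => L * (1 / (((k + K : ℕ) : ℝ) + 1)) := by
      refine hs.of_nonneg_of_le (fun k => by positivity) fun k => ?_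
      rw [mul_one_div]
      have := hle k
      gcongr
    rw [summable_mul_left_iff h.ne',
      summable_nat_add_iff (f := fun k : ℕ => 1 / ((k : ℝ) + 1)) K] at hs'
    refine Real.not_summable_one_div_natCast ((summable_nat_add_iff 1).1 ?_)
    simpa using hs'

theorem hasSum_altBinom_sub_succ {b : ℝ} (hb : 0 < b) :
    HasSum (fun k => altBinom b k - altBinom b (k + 1)) 1 := by
  rw [← altBinom_zero b]
  refine hasSum_sub_succ_of_tendsto_zero ?_ (tendsto_altBinom hb)
  simp only [altBinom_sub_succ]
  refine Summable.mul_left b (Summable.of_abs ?_)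
  refine (summable_abs_altBinom_div hb).congr fun k => ?_
  rw [abs_div, abs_of_pos (by positivity : (0 : ℝ) < (k : ℝ) + 1)]

/-- The value `k! m! / (k + m + 1)!` of the Beta function at `(k + 1, m + 1)`. -/
noncomputable def natBeta (k m : ℕ) : ℝ :=
  (k.factorial * m.factorial : ℝ) / (k + m + 1).factorial

theorem natBeta_nonneg (k m : ℕ) : 0 ≤ natBeta k m := by
  unfold natBeta; positivity

theorem natBeta_comm (k m : ℕ) : natBeta k m = natBeta m k := by
  simp only [natBeta, add_comm k m, mul_comm]

theorem natBeta_le (k m : ℕ) : natBeta k m ≤ 1 / ((m : ℝ) + 1) := by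
  have h : k.factorial * (m + 1).factorial ≤ (k + m + 1).factorial :=
    Nat.le_of_dvd (Nat.factorial_pos _) (Nat.factorial_mul_factorial_dvd_factorial_add k (m + 1))
  rw [Nat.factorial_succ] at h
  have h' : (k.factorial * ((m + 1) * m.factorial) : ℝ) ≤ (k + m + 1).factorial := by
    exact_mod_cast h
  unfold natBeta
  rw [div_le_div_iff₀ (by positivity) (by positivity)]
  linarith

theorem natBeta_zero_left (m : ℕ) : natBeta 0 m = 1 / ((m : ℝ) + 1) := by
  have : (m.factorial : ℝ) ≠ 0 := by positivity
  simp only [natBeta, zero_add, Nat.factorial_succ, Nat.factorial_zero]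
  push_cast
  field_simp

theorem natBeta_sub_succ (k m : ℕ) : natBeta k m - natBeta k (m + 1) = natBeta (k + 1) m := by
  have h1 : k + (m + 1) + 1 = k + m + 1 + 1 := by ring
  have h2 : k + 1 + m + 1 = k + m + 1 + 1 := by ring
  have : ((k + m + 1).factorial : ℝ) ≠ 0 := by positivity
  simp only [natBeta, h1, h2, Nat.factorial_succ (k + m + 1), Nat.factorial_succ k,
    Nat.factorial_succ m]
  push_cast
  field_simp
  ring

theorem hasSum_natBeta_succ (k : ℕ) :
    HasSum (fun m => natBeta (k + 1) m) (1 / ((k : ℝ) + 1)) := by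
  simp only [← natBeta_sub_succ]
  rw [← natBeta_zero_left, natBeta_comm]
  refine hasSum_sub_succ_of_antitone (antitone_nat_of_succ_le fun m => ?_) ?_
  · rw [← sub_nonneg, natBeta_sub_succ]
    exact natBeta_nonneg _ _
  · exact squeeze_zero (natBeta_nonneg k) (natBeta_le k) tendsto_one_div_add_atTop_nhds_zero_nat

theorem hasSum_altBinom_mul_natBeta {b : ℝ} (hb : 0 < b) (m : ℕ) :
    HasSum (fun k => altBinom b k * natBeta k m) (1 / ((m : ℝ) + b)) := by
  have hmb : (m : ℝ) + b ≠ 0 := by positivity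
  set c : ℕ → ℝ := fun k => altBinom b k * (((k : ℝ) + m + 1) * natBeta k m) / (m + b) with hc
  have hsub (k : ℕ) : altBinom b k * natBeta k m = c k - c (k + 1) := by
    have h2 : k + 1 + m + 1 = k + m + 1 + 1 := by ring
    have h3 : ((k + m + 1).factorial : ℝ) ≠ 0 := by positivity
    have h4 : (k : ℝ) + m + 1 + 1 ≠ 0 := by positivity
    have h5 : (((k + 1 : ℕ) : ℝ) + m + 1) * natBeta (k + 1) m = (k + 1) * natBeta k m := by
      simp only [natBeta, h2, Nat.factorial_succ (k + m + 1), Nat.factorial_succ k]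
      push_cast
      field_simp
      ring
    have h6 := succ_mul_altBinom_succ b k
    simp only [hc, h5]
    rw [← sub_div, eq_div_iff hmb]
    linear_combination natBeta k m * h6
  have hc0 : c 0 = 1 / ((m : ℝ) + b) := by
    have : (m : ℝ) + 1 ≠ 0 := by positivity
    simp only [hc, altBinom_zero, natBeta_zero_left]
    push_cast
    field_simp
    ring
  have hsum : Summable fun k => altBinom b k * natBeta k m := by
    refine Summable.of_norm_bounded (summable_abs_altBinom_div hb) fun k => ?_
    rw [Real.norm_eq_abs, abs_mul, abs_of_nonneg (natBeta_nonneg k m), div_eq_mul_one_div,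
      natBeta_comm]
    gcongr
    exact natBeta_le m k
  have hlim : Tendsto c atTop (𝓝 0) := by
    have habs : Tendsto (fun k => |altBinom b k| * (((m : ℝ) + 1) / (m + b))) atTop (𝓝 0) := by
      simpa using (tendsto_altBinom hb).abs.mul_const (((m : ℝ) + 1) / (m + b))
    refine squeeze_zero_norm (fun k => ?_) habs
    have h1 : ((k : ℝ) + m + 1) * natBeta k m ≤ m + 1 := by
      have hk := natBeta_le m k
      have hm := natBeta_le k m
      rw [natBeta_comm, le_div_iff₀ (by positivity)] at hk
      have hn := natBeta_nonneg k m
      have : natBeta k m ≤ 1 := hm.trans (by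
        rw [div_le_one (by positivity)]; linarith [(m.cast_nonneg : (0 : ℝ) ≤ m)])
      nlinarith [(m.cast_nonneg : (0 : ℝ) ≤ m)]
    have h2 : 0 ≤ ((k : ℝ) + m + 1) * natBeta k m :=
      mul_nonneg (by positivity) (natBeta_nonneg k m)
    simp only [hc]
    rw [Real.norm_eq_abs, abs_div, abs_mul, abs_of_nonneg h2,
      abs_of_pos (by positivity : 0 < (m : ℝ) + b), mul_div_assoc]
    gcongr
  rw [← hc0]
  simp only [hsub] at hsum ⊢
  exact hasSum_sub_succ_of_tendsto_zero hsum hlim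

theorem summable_abs_altBinom_succ_div {b : ℝ} (hb : 0 < b) :
    Summable fun k : ℕ => |altBinom b (k + 1)| * (1 / ((k : ℝ) + 1)) := by
  refine (((summable_nat_add_iff 1).2 (summable_abs_altBinom_div hb)).mul_left 2).of_nonneg_of_le
    (fun k => by positivity) fun k => ?_
  have h : 1 / ((k : ℝ) + 1) ≤ 2 / (((k + 1 : ℕ) : ℝ) + 1) := by
    rw [div_le_div_iff₀ (by positivity) (by positivity)]
    push_cast
    linarith [(k.cast_nonneg : (0 : ℝ) ≤ k)]
  calc _ ≤ |altBinom b (k + 1)| * (2 / (((k + 1 : ℕ) : ℝ) + 1)) := by gcongr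
    _ = _ := by ring

theorem exists_hasSum_altBinom_div {b : ℝ} (hb : 0 < b) :
    ∃ G, HasSum (fun k : ℕ => altBinom b (k + 1) / ((k : ℝ) + 1)) G ∧
      HasSum (fun m : ℕ => 1 / ((m : ℝ) + b) - 1 / ((m : ℝ) + 1)) G := by
  set f : ℕ × ℕ → ℝ := fun p => altBinom b (p.1 + 1) * natBeta (p.1 + 1) p.2 with hf
  have habs (k m : ℕ) : |f (k, m)| = |altBinom b (k + 1)| * natBeta (k + 1) m := by
    simp only [hf]
    rw [abs_mul, abs_of_nonneg (natBeta_nonneg _ _)]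
  have hrow (k : ℕ) := (hasSum_natBeta_succ k).mul_left |altBinom b (k + 1)|
  have hsum : Summable f := by
    refine Summable.of_abs ((summable_prod_of_nonneg fun p => abs_nonneg _).2 ⟨fun k => ?_, ?_⟩)
    · simp only [habs]
      exact (hrow k).summable
    · simp only [habs, fun k => (hrow k).tsum_eq]
      exact summable_abs_altBinom_succ_div hb
  refine ⟨∑' p, f p, ?_, ?_⟩
  · refine hsum.hasSum.prod_fiberwise fun k => ?_
    rw [div_eq_mul_one_div]
    exact (hasSum_natBeta_succ k).mul_left _
  · have hswap := (Equiv.prodComm ℕ ℕ).hasSum_iff.2 hsum.hasSum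
    refine hswap.prod_fiberwise fun m => ?_
    have h := (hasSum_nat_add_iff' 1).2 (hasSum_altBinom_mul_natBeta hb m)
    simpa [altBinom_zero, natBeta_zero_left] using h

theorem exists_hasSum_altBinom_div_sub (n : ℕ) {b : ℝ} (hb : 0 < b)
    (hbn : ∀ m : ℕ, b ≠ (m : ℝ)) :
    ∃ R, HasSum (fun k : ℕ => if k = n then 0 else
        (1 / ((k : ℝ) - n) - 1 / ((k : ℝ) + b - n))) R ∧
      HasSum (fun k : ℕ => if k = n then 0 else altBinom b k / ((k : ℝ) - n))
        (-altBinom b n * (R - 1 / b)) := by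
  induction n with
  | zero =>
    obtain ⟨G, h1, h2⟩ := exists_hasSum_altBinom_div hb
    have h3 : HasSum (fun k : ℕ => 1 / ((k : ℝ) + b) - 1 / (((k + 1 : ℕ) : ℝ) + b)) (1 / b) := by
      have anti : Antitone fun k : ℕ => 1 / ((k : ℝ) + b) := fun i j hij => by
        have : (i : ℝ) ≤ j := by exact_mod_cast hij
        dsimp only
        gcongr
      have lim : Tendsto (fun k : ℕ => 1 / ((k : ℝ) + b)) atTop (𝓝 0) :=
        (tendsto_atTop_add_const_right _ b tendsto_natCast_atTop_atTop).const_div_atTop 1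
      simpa using hasSum_sub_succ_of_antitone anti lim
    refine ⟨1 / b - G, (hasSum_nat_add_iff' 1).1 ((h3.sub h2).of_eq (fun k => ?_) ?_),
      (hasSum_nat_add_iff' 1).1 (h1.of_eq (fun k => ?_) ?_)⟩
    · simp
    · simp
    · simp
    · simp [altBinom_zero]
  | succ n ih =>
    obtain ⟨R, hR, hS⟩ := ih
    have hn : (n : ℝ) + 1 ≠ 0 := by positivity
    have hb' : b - (n + 1) ≠ 0 := sub_ne_zero.2 (by exact_mod_cast hbn (n + 1))
    have hrec := succ_mul_altBinom_succ b n
    refine ⟨R + (-(1 / ((n : ℝ) + 1)) - 1 / (b - (n + 1))), ?_, ?_⟩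
    · refine (hasSum_nat_add_iff' 1).1 (hR.of_eq (fun k => ?_) ?_)
      · have h1 : ((k + 1 : ℕ) : ℝ) - (n + 1 : ℕ) = k - n := by push_cast; ring
        have h2 : ((k + 1 : ℕ) : ℝ) + b - (n + 1 : ℕ) = k + b - n := by push_cast; ring
        simp only [add_left_inj, h1, h2]
      · have h0 : (0 : ℝ) - (n + 1) = -(n + 1) := zero_sub _
        have h0' : (0 : ℝ) + b - (n + 1) = b - (n + 1) := by ring
        simp only [Finset.sum_range_one, n.succ_ne_zero.symm, if_false, Nat.cast_zero,
          Nat.cast_add, Nat.cast_one, h0, h0', one_div_neg_eq_neg_one_div, add_sub_cancel_right]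
    · have h1 := ((hasSum_altBinom_sub_succ hb).sub
        (hasSum_ite_eq n (altBinom b n - altBinom b (n + 1)))).add (hS.mul_left ((n : ℝ) + 1 - b))
      refine (hasSum_nat_add_iff' 1).1 ((h1.div_const ((n : ℝ) + 1)).of_eq (fun k => ?_) ?_)
      · by_cases hk : k = n
        · simp [hk]
        · have hkn : (k : ℝ) - n ≠ 0 := sub_ne_zero.2 (by exact_mod_cast hk)
          have hk1 := succ_mul_altBinom_succ b k
          have h2 : ((k + 1 : ℕ) : ℝ) - (n + 1 : ℕ) = k - n := by push_cast; ring
          simp only [add_left_inj, hk, if_false, h2]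
          field_simp
          linear_combination hk1
      · have h0 : (0 : ℝ) - (n + 1) = -(n + 1) := zero_sub _
        have ha : altBinom b n = -((n + 1) * altBinom b (n + 1) / (b - (n + 1))) := by
          field_simp
          linarith
        simp only [Finset.sum_range_one, n.succ_ne_zero.symm, if_false, Nat.cast_zero,
          Nat.cast_add, Nat.cast_one, h0, altBinom_zero, one_div_neg_eq_neg_one_div, ha]
        field_simp
        ring

theorem stmt_9 (n : ℕ) (b : ℝ) (hb : 0 < b) (hbz : ∀ m : ℤ, b ≠ (m : ℝ)) :
    (∑' k : ℕ, if k = n then 0 else genBinomR b k * (-1) ^ k / ((k : ℝ) - n))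
      = -(genBinomR b n * (-1) ^ n) *
        ((∑' k : ℕ, if k = n then 0 else
            (1 / ((k : ℝ) - n) - 1 / ((k : ℝ) + b - n))) - 1 / b) := by
  obtain ⟨R, hR, hS⟩ := exists_hasSum_altBinom_div_sub n hb fun m => by exact_mod_cast hbz m
  rw [hR.tsum_eq]
  exact hS.tsum_eq
end
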